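/- Let A = (α_{ij}) and D = (δ_{ij}) be m×n matrices over 𝔼, let B = (β_{ij}) and C = (γ_{ij}) be n×p matrices over 𝔼, and let α, β be external numbers. (1) If R(α) ≤ max{R(α_{ij}), R(δ_{ij})} for all i ≤ m, j ≤ n, or if α_{ij} and δ_{ij} are not nearly opposite for all i, j, then α(A + D) = αA + αD. (2) If R(α_{ij}) ≤ max{R(α), R(β)} for all i, j, or if α and β are not nearly opposite, then (α + β)A = αA + βA. (3) If max_{i≤m, j≤n} R(α_{ij}) ≤ max{R(β_{rj}), R(γ_{rj})} for all r ≤ n, j ≤ p, or if β_{rj} and γ_{rj} are not nearly opposite for all r, j, then A(B + C) = AB + AC. -/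

import Mathlib

open scoped Pointwise Classical

noncomputable section

-- Note: `ℝ*` is Mathlib's notation for the hyperreals `Hyperreal`.

/-- A neutrix: an order-convex additive subgroup of the hyperreals. -/
def IsNeutrix (A : Set ℝ*) : Prop :=
  (0 : ℝ*) ∈ A ∧ (∀ x ∈ A, ∀ y ∈ A, x + y ∈ A) ∧ (∀ x ∈ A, -x ∈ A) ∧
    ∀ x ∈ A, ∀ y ∈ A, ∀ z : ℝ*, x ≤ z → z ≤ y → z ∈ A

/-- The coset `a + A`. -/
def coset (a : ℝ*) (A : Set ℝ*) : Set ℝ* := {x | ∃ u ∈ A, x = a + u}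

/-- `α` is an external number: a coset of a neutrix. -/
def IsExt (α : Set ℝ*) : Prop := ∃ a A, IsNeutrix A ∧ α = coset a A

/-- The neutrix part `N(α)` of an external number, as the set of differences. -/
def Nx (α : Set ℝ*) : Set ℝ* := {d | ∃ x ∈ α, ∃ y ∈ α, d = x - y}

/-- An external number is zeroless if it does not contain `0`. -/
def Zeroless (α : Set ℝ*) : Prop := (0 : ℝ*) ∉ α

/-- Multiplication of external numbers: `αβ = ab + aB + bA + AB`
(independent of the chosen representatives). -/
def emul (α β : Set ℝ*) : Set ℝ* :=
  {z | ∃ a A b B, IsNeutrix A ∧ IsNeutrix B ∧ α = coset a A ∧ β = coset b B ∧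
      ∃ u ∈ A, ∃ v ∈ B, ∃ u' ∈ A, ∃ v' ∈ B, z = a * b + a * v + b * u + u' * v'}

/-- Multiplication of an external number by a hyperreal scalar: `t·α = ta + tA`. -/
def esmul (t : ℝ*) (α : Set ℝ*) : Set ℝ* := (fun x => t * x) '' α

/-- Inverse of a (zeroless) external number: `1/α = 1/a + A/a²`. -/
def einv (α : Set ℝ*) : Set ℝ* :=
  {z | ∃ a A, IsNeutrix A ∧ α = coset a A ∧ ∃ u ∈ A, z = a⁻¹ + u / a ^ 2}

/-- Division of external numbers: `α/β = α · (1/β)`. -/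
def ediv (α β : Set ℝ*) : Set ℝ* := emul α (einv β)

/-- The neutrix `⊘` of infinitesimal hyperreals. -/
def oslash : Set ℝ* := {x | Hyperreal.Infinitesimal x}

/-- Relative uncertainty `R(α)`: `A/a` if `α = a + A` is zeroless,
and all of `ℝ*` if `α` is a neutrix. -/
def RU (α : Set ℝ*) : Set ℝ* :=
  if (0 : ℝ*) ∈ α then Set.univ
  else {z | ∃ a A, IsNeutrix A ∧ α = coset a A ∧ ∃ u ∈ A, z = u / a}

/-- `α` and `β` are nearly opposite: both zeroless and `α/β ⊆ -1 + ⊘`. -/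
def NearlyOpposite (α β : Set ℝ*) : Prop :=
  Zeroless α ∧ Zeroless β ∧ ediv α β ⊆ coset (-1) oslash

/-- Order on external numbers: `α ≤ β` iff `∀ x ∈ α, ∃ y ∈ β, x ≤ y`. -/
def ele (α β : Set ℝ*) : Prop := ∀ x ∈ α, ∃ y ∈ β, x ≤ y

/-- `α` is non-negative: some element of `α` is `≥ 0`. -/
def eNonneg (α : Set ℝ*) : Prop := ∃ x ∈ α, (0 : ℝ*) ≤ x

/-- Absolute value of an external number: `|α| = |a| + A`. -/
def eabs (α : Set ℝ*) : Set ℝ* :=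
  {z | ∃ a A, IsNeutrix A ∧ α = coset a A ∧ ∃ u ∈ A, z = |a| + u}

/-- Product of a finite family of external numbers. -/
def eprod : ∀ {n : ℕ}, (Fin n → Set ℝ*) → Set ℝ*
  | 0, _ => {1}
  | _ + 1, f => emul (f 0) (eprod fun i => f i.succ)

/-- Power of an external number. -/
def epow (α : Set ℝ*) : ℕ → Set ℝ*
  | 0 => {1}
  | k + 1 => emul α (epow α k)

/-- Matrix product over external numbers: `(AB)_{ij} = Σ_k α_{ik}β_{kj}`. -/
def matMul {m n p : ℕ} (M : Matrix (Fin m) (Fin n) (Set ℝ*))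
    (N : Matrix (Fin n) (Fin p) (Set ℝ*)) : Matrix (Fin m) (Fin p) (Set ℝ*) :=
  fun i j => ∑ k, emul (M i k) (N k j)

/-- Entrywise (Minkowski) sum of matrices over external numbers. -/
def matAdd {m n : ℕ} (M N : Matrix (Fin m) (Fin n) (Set ℝ*)) :
    Matrix (Fin m) (Fin n) (Set ℝ*) := fun i j => M i j + N i j

/-- Entrywise scalar multiple of a matrix by an external number. -/
def matSmul {m n : ℕ} (α : Set ℝ*) (M : Matrix (Fin m) (Fin n) (Set ℝ*)) :
    Matrix (Fin m) (Fin n) (Set ℝ*) := fun i j => emul α (M i j)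

/-- Entrywise inclusion of matrices over external numbers. -/
def matIncl {m n : ℕ} (M N : Matrix (Fin m) (Fin n) (Set ℝ*)) : Prop :=
  ∀ i j, M i j ⊆ N i j

/-- Determinant of a square matrix over the external numbers. -/
def detE {n : ℕ} (M : Matrix (Fin n) (Fin n) (Set ℝ*)) : Set ℝ* :=
  ∑ σ : Equiv.Perm (Fin n),
    esmul ((Equiv.Perm.sign σ : ℤ) : ℝ*) (eprod fun i => M i (σ i))

/-- The `(i,j)` minor of a square matrix over the external numbers. -/
def minorE {n : ℕ} (M : Matrix (Fin (n + 1)) (Fin (n + 1)) (Set ℝ*))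
    (i j : Fin (n + 1)) : Set ℝ* :=
  detE (M.submatrix i.succAbove j.succAbove)

/-- The near-identity matrix `I_n(N)`: diagonal entries `1 + N`, off-diagonal entries `N`. -/
def Iun (n : ℕ) (N : Set ℝ*) : Matrix (Fin n) (Fin n) (Set ℝ*) :=
  fun i j => if i = j then coset 1 N else N

/-- A finite family of vectors of external numbers is linearly dependent:
some nontrivial real (hyperreal) linear combination is a neutrix vector. -/
def LinDepE {ι : Type*} [Fintype ι] {n : ℕ} (ξ : ι → Fin n → Set ℝ*) : Prop :=
  ∃ t : ι → ℝ*, (∃ i, t i ≠ 0) ∧ ∃ A : Fin n → Set ℝ*,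
    (∀ j, IsNeutrix (A j)) ∧ ∀ j, (∑ i, esmul (t i) (ξ i j)) = A j

/-- The matrix has a zeroless minor of order `k`. -/
def HasZerolessMinor {m n : ℕ} (M : Matrix (Fin m) (Fin n) (Set ℝ*)) (k : ℕ) : Prop :=
  ∃ (f : Fin k → Fin m) (g : Fin k → Fin n), Function.Injective f ∧ Function.Injective g ∧
    Zeroless (detE fun i j => M (f i) (g j))

/-- The minor rank of `M` is `r`. -/
def minorRankIs {m n : ℕ} (M : Matrix (Fin m) (Fin n) (Set ℝ*)) (r : ℕ) : Prop :=
  HasZerolessMinor M r ∧ ∀ k, HasZerolessMinor M k → k ≤ r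

/-- The row rank of `M` is `r`: the maximal cardinality of a linearly
independent set of row vectors of `M` is `r`. -/
def rowRankIs {m n : ℕ} (M : Matrix (Fin m) (Fin n) (Set ℝ*)) (r : ℕ) : Prop :=
  (∃ s : Finset (Fin m), s.card = r ∧ ¬ LinDepE fun (i : {x // x ∈ s}) j => M i.1 j) ∧
  ∀ s : Finset (Fin m), (¬ LinDepE fun (i : {x // x ∈ s}) j => M i.1 j) → s.card ≤ r

/-- `M` is a reduced matrix: `max_{i,j} |α_{ij}| = 1 + A₀` for some neutrix `A₀ ⊆ ⊘`. -/
def IsReducedMat {m n : ℕ} (M : Matrix (Fin m) (Fin n) (Set ℝ*)) : Prop :=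
  ∃ A₀, IsNeutrix A₀ ∧ A₀ ⊆ oslash ∧ (∃ i j, eabs (M i j) = coset 1 A₀) ∧
    ∀ i j, ele (eabs (M i j)) (coset 1 A₀)

set_option linter.deprecated false

theorem IsNeutrix.mem_of_abs_le {A : Set ℝ*} (hA : IsNeutrix A) {x y : ℝ*} (hx : x ∈ A)
    (h : |y| ≤ |x|) : y ∈ A := by
  obtain ⟨-, -, hneg, hconv⟩ := hA
  have habs : |x| ∈ A := by
    rcases abs_choice x with h' | h' <;> rw [h']
    exacts [hx, hneg x hx]
  exact hconv _ (hneg _ habs) _ habs y (abs_le.1 h).1 (abs_le.1 h).2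

theorem IsNeutrix.sub_mem {A : Set ℝ*} (hA : IsNeutrix A) {x y : ℝ*} (hx : x ∈ A) (hy : y ∈ A) :
    x - y ∈ A := by
  rw [sub_eq_add_neg]
  exact hA.2.1 x hx _ (hA.2.2.1 y hy)

theorem IsNeutrix.natCast_mul_mem {A : Set ℝ*} (hA : IsNeutrix A) {x : ℝ*} (hx : x ∈ A) (n : ℕ) :
    (n : ℝ*) * x ∈ A := by
  induction n with
  | zero => simpa using hA.1
  | succ n ih =>
    have := hA.2.1 _ ih _ hx
    rwa [Nat.cast_succ, add_mul, one_mul]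

theorem IsNeutrix.mul_mem_of_abs_le_natCast {A : Set ℝ*} (hA : IsNeutrix A) {x t : ℝ*} {n : ℕ}
    (hx : x ∈ A) (ht : |t| ≤ n) : t * x ∈ A := by
  refine hA.mem_of_abs_le (hA.natCast_mul_mem hx n) ?_
  rw [abs_mul, abs_mul, Nat.abs_cast]
  gcongr

theorem IsNeutrix.add {B C : Set ℝ*} (hB : IsNeutrix B) (hC : IsNeutrix C) :
    IsNeutrix (B + C) := by
  have hBC : ∀ x ∈ B + C, ∀ z, |z| ≤ |x| → z ∈ B + C := by
    rintro _ ⟨b, hb, c, hc, rfl⟩ z hz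
    have hz' : |z| ≤ |b| + |c| := hz.trans (abs_add_le b c)
    rcases le_total |b| |c| with h | h
    · refine ⟨0, hB.1, z, hC.mem_of_abs_le (hC.2.1 c hc c hc) ?_, zero_add z⟩
      rw [← two_mul, abs_mul, abs_two]
      linarith
    · refine ⟨z, hB.mem_of_abs_le (hB.2.1 b hb b hb) ?_, 0, hC.1, add_zero z⟩
      rw [← two_mul, abs_mul, abs_two]
      linarith
  refine ⟨⟨0, hB.1, 0, hC.1, add_zero 0⟩, ?_, fun x hx => hBC x hx _ (abs_neg x).le, ?_⟩
  · rintro _ ⟨b, hb, c, hc, rfl⟩ _ ⟨b', hb', c', hc', rfl⟩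
    exact ⟨b + b', hB.2.1 b hb b' hb', c + c', hC.2.1 c hc c' hc', add_add_add_comm b b' c c'⟩
  · intro x hx y hy z hxz hzy
    rcases le_total 0 z with h | h
    · exact hBC y hy z (by rwa [abs_of_nonneg h, abs_of_nonneg (h.trans hzy)])
    · exact hBC x hx z (by
        rw [abs_of_nonpos h, abs_of_nonpos (hxz.trans h)]
        exact neg_le_neg hxz)

theorem IsNeutrix.exists_mul_add_mul_eq {A B : Set ℝ*} (hB : IsNeutrix B)
    {u v x y : ℝ*} (hu : u ∈ A) (hv : v ∈ B) (hx : x ∈ A) (hy : y ∈ B) :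
    ∃ s ∈ A, ∃ t ∈ B, u * v + x * y = s * t := by
  have aux : ∀ {u v x y : ℝ*}, v ∈ B → x ∈ A → y ∈ B → |u| ≤ |x| →
      ∃ s ∈ A, ∃ t ∈ B, u * v + x * y = s * t := by
    intro u v x y hv hx hy h
    by_cases hx0 : x = 0
    · have hu0 : u = 0 := by simpa [hx0] using h
      exact ⟨x, hx, y, hy, by simp [hu0]⟩
    · have ht : |u / x| ≤ (1 : ℕ) := by
        rw [abs_div, Nat.cast_one]
        exact div_le_one_of_le₀ h (abs_nonneg x)
      refine ⟨x, hx, u / x * v + y,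
        hB.2.1 _ (hB.mul_mem_of_abs_le_natCast hv ht) _ hy, ?_⟩
      field_simp
  rcases le_total |u| |x| with h | h
  · exact aux hv hx hy h
  · rw [add_comm]
    exact aux hy hu hv h

theorem coset_eq_coset {a b : ℝ*} {A B : Set ℝ*} (hA : IsNeutrix A) (hB : IsNeutrix B)
    (h : coset a A = coset b B) : A = B ∧ b - a ∈ A := by
  have key : ∀ {a b : ℝ*} {A B : Set ℝ*}, IsNeutrix A → IsNeutrix B →
      coset a A = coset b B → A ⊆ B := by
    intro a b A B hA hB h u hu
    obtain ⟨v, hv, hv'⟩ : a + u ∈ coset b B := h ▸ ⟨u, hu, rfl⟩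
    obtain ⟨w, hw, hw'⟩ : a ∈ coset b B := h ▸ ⟨0, hA.1, (add_zero a).symm⟩
    have : u = v - w := by linear_combination hv' - hw'
    exact this ▸ hB.sub_mem hv hw
  refine ⟨(key hA hB h).antisymm (key hB hA h.symm), ?_⟩
  obtain ⟨v, hv, hv'⟩ : b ∈ coset a A := h ▸ ⟨0, hB.1, (add_zero b).symm⟩
  rwa [hv', add_sub_cancel_left]

theorem zero_mem_coset_iff {a : ℝ*} {A : Set ℝ*} (hA : IsNeutrix A) :
    (0 : ℝ*) ∈ coset a A ↔ a ∈ A := by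
  constructor
  · rintro ⟨u, hu, h⟩
    rw [eq_neg_of_add_eq_zero_left h.symm]
    exact hA.2.2.1 u hu
  · exact fun h => ⟨-a, hA.2.2.1 a h, (add_neg_cancel a).symm⟩

theorem coset_add_coset (b c : ℝ*) (B C : Set ℝ*) :
    coset b B + coset c C = coset (b + c) (B + C) := by
  ext z
  constructor
  · rintro ⟨_, ⟨u, hu, rfl⟩, _, ⟨v, hv, rfl⟩, rfl⟩
    exact ⟨u + v, ⟨u, hu, v, hv, rfl⟩, add_add_add_comm b u c v⟩
  · rintro ⟨_, ⟨u, hu, v, hv, rfl⟩, rfl⟩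
    exact ⟨b + u, ⟨u, hu, rfl⟩, c + v, ⟨v, hv, rfl⟩, (add_add_add_comm b c u v).symm⟩

/-- The neutrix part `aB + bA + AB` of the product of `a + A` and `b + B`. -/
def mulError (a : ℝ*) (A : Set ℝ*) (b : ℝ*) (B : Set ℝ*) : Set ℝ* :=
  {w | ∃ u ∈ A, ∃ v ∈ B, ∃ u' ∈ A, ∃ v' ∈ B, w = a * v + b * u + u' * v'}

theorem mulError_add_mem {a b : ℝ*} {A B : Set ℝ*} (hA : IsNeutrix A) (hB : IsNeutrix B)
    {x y : ℝ*} (hx : x ∈ mulError a A b B) (hy : y ∈ mulError a A b B) :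
    x + y ∈ mulError a A b B := by
  obtain ⟨u, hu, v, hv, u', hu', v', hv', rfl⟩ := hx
  obtain ⟨w, hw, z, hz, w', hw', z', hz', rfl⟩ := hy
  obtain ⟨s, hs, t, ht, hst⟩ := hB.exists_mul_add_mul_eq hu' hv' hw' hz'
  exact ⟨u + w, hA.2.1 u hu w hw, v + z, hB.2.1 v hv z hz, s, hs, t, ht, by
    linear_combination hst⟩

theorem left_mul_mem_mulError {a b : ℝ*} {A B : Set ℝ*} (hA : IsNeutrix A) (hB : IsNeutrix B)
    {v : ℝ*} (hv : v ∈ B) : a * v ∈ mulError a A b B :=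
  ⟨0, hA.1, v, hv, 0, hA.1, 0, hB.1, by ring⟩

theorem right_mul_mem_mulError {a b : ℝ*} {A B : Set ℝ*} (hA : IsNeutrix A) (hB : IsNeutrix B)
    {u : ℝ*} (hu : u ∈ A) : b * u ∈ mulError a A b B :=
  ⟨u, hu, 0, hB.1, 0, hA.1, 0, hB.1, by ring⟩

theorem mul_mem_mulError {a b : ℝ*} {A B : Set ℝ*} (hA : IsNeutrix A) (hB : IsNeutrix B)
    {u v : ℝ*} (hu : u ∈ A) (hv : v ∈ B) : u * v ∈ mulError a A b B :=
  ⟨0, hA.1, 0, hB.1, u, hu, v, hv, by ring⟩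

theorem emul_coset_coset {a b : ℝ*} {A B : Set ℝ*} (hA : IsNeutrix A) (hB : IsNeutrix B) :
    emul (coset a A) (coset b B) = coset (a * b) (mulError a A b B) := by
  ext z
  constructor
  · rintro ⟨a', A', b', B', hA', hB', hα, hβ, u, hu, v, hv, u', hu', v', hv', rfl⟩
    obtain ⟨rfl, ha⟩ := coset_eq_coset hA hA' hα
    obtain ⟨rfl, hb⟩ := coset_eq_coset hB hB' hβ
    have hM {x y : ℝ*} := @mulError_add_mem a b A B hA hB x y
    refine ⟨a * (b' - b + v) + b * (a' - a + u) + (a' - a) * (b' - b + v) + u * (b' - b)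
      + u' * v', ?_, by ring⟩
    have hbv := hB.2.1 _ hb _ hv
    exact hM (hM (hM (hM (left_mul_mem_mulError hA hB hbv)
      (right_mul_mem_mulError hA hB (hA.2.1 _ ha _ hu))) (mul_mem_mulError hA hB ha hbv))
      (mul_mem_mulError hA hB hu hb)) (mul_mem_mulError hA hB hu' hv')
  · rintro ⟨_, ⟨u, hu, v, hv, u', hu', v', hv', rfl⟩, rfl⟩
    exact ⟨a, A, b, B, hA, hB, rfl, rfl, u, hu, v, hv, u', hu', v', hv', by ring⟩

theorem emul_comm (α β : Set ℝ*) : emul α β = emul β α := by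
  have key : ∀ α β : Set ℝ*, emul α β ⊆ emul β α := by
    rintro α β _ ⟨a, A, b, B, hA, hB, hα, hβ, u, hu, v, hv, u', hu', v', hv', rfl⟩
    exact ⟨b, B, a, A, hB, hA, hβ, hα, v, hv, u, hu, v', hv', u', hu', by ring⟩
  exact (key α β).antisymm (key β α)

theorem emul_coset_add_of_forall_mem {a b c : ℝ*} {A B C : Set ℝ*} (hA : IsNeutrix A)
    (hB : IsNeutrix B) (hC : IsNeutrix C)
    (h : ∀ u ∈ A, b * u ∈ mulError a A (b + c) (B + C)) :
    emul (coset a A) (coset b B + coset c C) =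
      emul (coset a A) (coset b B) + emul (coset a A) (coset c C) := by
  have hBC := hB.add hC
  rw [coset_add_coset, emul_coset_coset hA hBC, emul_coset_coset hA hB, emul_coset_coset hA hC,
    coset_add_coset, ← mul_add]
  congr 1
  ext z
  constructor
  · rintro ⟨u, hu, _, ⟨v, hv, w, hw, rfl⟩, u', hu', _, ⟨v', hv', w', hw', rfl⟩, rfl⟩
    exact ⟨_, ⟨u, hu, v, hv, u', hu', v', hv', rfl⟩, _, ⟨u, hu, w, hw, u', hu', w', hw', rfl⟩,
      by ring⟩
  · rintro ⟨_, ⟨u, hu, v, hv, u', hu', v', hv', rfl⟩, _, ⟨x, hx, w, hw, x', hx', w', hw', rfl⟩,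
      rfl⟩
    have hM {x y : ℝ*} := @mulError_add_mem a (b + c) A (B + C) hA hBC x y
    have hmem := hM (hM (hM (hM (left_mul_mem_mulError hA hBC ⟨v, hv, w, hw, rfl⟩)
      (right_mul_mem_mulError hA hBC hx)) (h _ (hA.sub_mem hu hx)))
      (mul_mem_mulError hA hBC hu' ⟨v', hv', 0, hC.1, rfl⟩))
      (mul_mem_mulError hA hBC hx' ⟨0, hB.1, w', hw', rfl⟩)
    convert hmem using 1
    ring

theorem exists_abs_inv_le_natCast_of_not_infinitesimal {x : ℝ*}
    (hx : ¬ Hyperreal.Infinitesimal x) : x ≠ 0 ∧ ∃ n : ℕ, |x⁻¹| ≤ n := by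
  have hx0 : x ≠ 0 := by
    rintro rfl
    exact hx Hyperreal.infinitesimal_zero
  refine ⟨hx0, ?_⟩
  rw [Hyperreal.infinitesimal_iff, not_lt, ← ArchimedeanClass.mk_one,
    ArchimedeanClass.mk_le_mk] at hx
  obtain ⟨n, hn⟩ := hx
  refine ⟨n, ?_⟩
  rw [abs_one, nsmul_eq_mul] at hn
  rw [abs_inv]
  exact (inv_le_iff_one_le_mul₀ (abs_pos.2 hx0)).2 hn

theorem IsNeutrix.isSt_div_zero {A : Set ℝ*} (hA : IsNeutrix A) {a u : ℝ*} (ha : a ∉ A)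
    (hu : u ∈ A) : Hyperreal.IsSt (u / a) 0 := by
  by_contra h
  obtain ⟨h0, n, hn⟩ := exists_abs_inv_le_natCast_of_not_infinitesimal h
  have hu0 : u ≠ 0 := (div_ne_zero_iff.1 h0).1
  rw [inv_div] at hn
  have := hA.mul_mem_of_abs_le_natCast hu hn
  rw [div_mul_cancel₀ _ hu0] at this
  exact ha this

theorem IsNeutrix.isSt_div_one {A : Set ℝ*} (hA : IsNeutrix A) {a x : ℝ*} (ha : a ∉ A)
    (hx : x - a ∈ A) : Hyperreal.IsSt (x / a) 1 := by
  have ha0 : a ≠ 0 := fun h => ha (h ▸ hA.1)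
  have h1 : Hyperreal.IsSt (1 : ℝ*) 1 := Hyperreal.isSt_refl_real 1
  have := h1.add (hA.isSt_div_zero ha hx)
  rw [sub_div, div_self ha0, add_sub_cancel, add_zero] at this
  exact this

theorem isSt_mul_of_mem_einv {c d : ℝ*} {C : Set ℝ*} (hC : IsNeutrix C) (hc : c ∉ C)
    (hd : d ∈ einv (coset c C)) : Hyperreal.IsSt (d * c) 1 := by
  obtain ⟨c', C', hC', h, w, hw, rfl⟩ := hd
  obtain ⟨rfl, hc'⟩ := coset_eq_coset hC hC' h
  have hc0 : c ≠ 0 := fun h => hc (h ▸ hC.1)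
  have hx := hC.isSt_div_one hc hc'
  have hx' := hx.inv (fun h0 => one_ne_zero (hx.unique h0))
  have := hx'.add (((hC.isSt_div_zero hc hw).mul hx').mul hx')
  have hc'0 : c' ≠ 0 := by
    rintro rfl
    rw [zero_sub] at hc'
    exact hc (neg_neg c ▸ hC.2.2.1 _ hc')
  convert this using 1
  · field_simp
  · norm_num

theorem nearlyOpposite_of_infinitesimal {b c : ℝ*} {B C : Set ℝ*} (hB : IsNeutrix B)
    (hC : IsNeutrix C) (hb : b ∉ B) (hc : c ∉ C)
    (h : Hyperreal.Infinitesimal ((b + c) / c)) :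
    NearlyOpposite (coset b B) (coset c C) := by
  have hb0 : b ≠ 0 := fun h => hb (h ▸ hB.1)
  have hc0 : c ≠ 0 := fun h => hc (h ▸ hC.1)
  have hbc : Hyperreal.IsSt (b / c) (-1) := by
    have := h.sub (Hyperreal.isSt_refl_real 1)
    rw [add_div, div_self hc0, zero_sub] at this
    simpa using this
  have hBc : ∀ u ∈ B, Hyperreal.IsSt (u / c) 0 := by
    intro u hu
    have := (hB.isSt_div_zero hb hu).mul hbc
    rwa [zero_mul, div_mul_div_cancel₀ hb0] at this
  refine ⟨fun h => hb ((zero_mem_coset_iff hB).1 h), fun h => hc ((zero_mem_coset_iff hC).1 h), ?_⟩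
  rintro _ ⟨b', B', d, D, hB', hD, hβ, hδ, u, hu, v, hv, u', hu', v', hv', rfl⟩
  obtain ⟨rfl, hb'⟩ := coset_eq_coset hB hB' hβ
  have hd : Hyperreal.IsSt (d * c) 1 :=
    isSt_mul_of_mem_einv hC hc (hδ ▸ ⟨0, hD.1, (add_zero d).symm⟩)
  have hD0 : ∀ w ∈ D, Hyperreal.IsSt (w * c) 0 := by
    intro w hw
    have := (isSt_mul_of_mem_einv hC hc (hδ ▸ ⟨w, hw, rfl⟩ : d + w ∈ einv (coset c C))).sub hd
    rwa [← sub_mul, add_sub_cancel_left, sub_self] at this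
  have hb'c : Hyperreal.IsSt (b' / c) (-1) := by
    have := (hBc _ hb').add hbc
    rwa [← add_div, sub_add_cancel, zero_add] at this
  have key := ((((hb'c.mul hd).add (hb'c.mul (hD0 v hv))).add (hd.mul (hBc u hu))).add
    ((hBc u' hu').mul (hD0 v' hv'))).sub (Hyperreal.isSt_refl_real (-1))
  refine ⟨b' * d + b' * v + d * u + u' * v' + 1, ?_, by ring⟩
  change Hyperreal.IsSt _ 0
  convert key using 1
  · push_cast
    field_simp
    ring
  · norm_num

theorem mem_RU_iff {a z : ℝ*} {A : Set ℝ*} (hA : IsNeutrix A) (ha : a ∉ A) :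
    z ∈ RU (coset a A) ↔ ∃ b, b - a ∈ A ∧ ∃ u ∈ A, z = u / b := by
  rw [RU, if_neg (fun h => ha ((zero_mem_coset_iff hA).1 h))]
  constructor
  · rintro ⟨b, B, hB, h, u, hu, rfl⟩
    obtain ⟨rfl, hb⟩ := coset_eq_coset hA hB h
    exact ⟨b, hb, u, hu, rfl⟩
  · rintro ⟨b, hb, u, hu, rfl⟩
    refine ⟨b, A, hA, ?_, u, hu, rfl⟩
    ext x
    constructor
    · rintro ⟨v, hv, rfl⟩
      exact ⟨v - (b - a), hA.sub_mem hv hb, by ring⟩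
    · rintro ⟨v, hv, rfl⟩
      exact ⟨b - a + v, hA.2.1 _ hb _ hv, by ring⟩

theorem RU_neg_mem {a z : ℝ*} {A : Set ℝ*} (hA : IsNeutrix A) (ha : a ∉ A)
    (hz : z ∈ RU (coset a A)) : -z ∈ RU (coset a A) := by
  rw [mem_RU_iff hA ha] at hz ⊢
  obtain ⟨b, hb, u, hu, rfl⟩ := hz
  exact ⟨b, hb, -u, hA.2.2.1 u hu, (neg_div b u).symm⟩

theorem one_notMem_RU {a : ℝ*} {A : Set ℝ*} (hA : IsNeutrix A) (ha : a ∉ A) :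
    (1 : ℝ*) ∉ RU (coset a A) := by
  rw [mem_RU_iff hA ha]
  rintro ⟨b, hb, u, hu, h⟩
  have hb0 : b ≠ 0 := by
    rintro rfl
    simp at h
  rw [eq_div_iff hb0, one_mul] at h
  have := hA.sub_mem hu hb
  rw [← h, sub_sub_cancel] at this
  exact ha this

theorem mul_mem_mulError_of_div_mem_RU {a b b' u : ℝ*} {A B B' : Set ℝ*} (hA : IsNeutrix A)
    (hB : IsNeutrix B) (hB' : IsNeutrix B') (hBB' : B ⊆ B') (ha : a ∉ A) (hb : b ∉ B)
    (hu : u ∈ A) (h : u / a ∈ RU (coset b B)) : b * u ∈ mulError a A b' B' := by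
  rw [mem_RU_iff hB hb] at h
  obtain ⟨x, hx, v, hv, h⟩ := h
  have ha0 : a ≠ 0 := fun h => ha (h ▸ hA.1)
  have hx0 : x ≠ 0 := by
    rintro rfl
    rw [zero_sub] at hx
    exact hb (neg_neg b ▸ hB.2.2.1 _ hx)
  rw [div_eq_div_iff ha0 hx0] at h
  have := mulError_add_mem hA hB' (left_mul_mem_mulError (a := a) (b := b') hA hB' (hBB' hv))
    (mul_mem_mulError hA hB' hu (hB'.2.2.1 _ (hBB' hx)))
  convert this using 1
  linear_combination h

theorem emul_add_of_RU_or_not_nearlyOpposite {α β γ : Set ℝ*} (hα : IsExt α) (hβ : IsExt β)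
    (hγ : IsExt γ) (h : RU α ⊆ RU β ∪ RU γ ∨ ¬ NearlyOpposite β γ) :
    emul α (β + γ) = emul α β + emul α γ := by
  obtain ⟨a, A, hA, rfl⟩ := hα
  obtain ⟨b, B, hB, rfl⟩ := hβ
  obtain ⟨c, C, hC, rfl⟩ := hγ
  have hBC := hB.add hC
  have hBle : B ⊆ B + C := fun x hx => ⟨x, hx, 0, hC.1, add_zero x⟩
  have hCle : C ⊆ B + C := fun x hx => ⟨0, hB.1, x, hx, zero_add x⟩
  refine emul_coset_add_of_forall_mem hA hB hC fun u hu => ?_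
  -- It is enough to control either `b * u` or `c * u`, as their sum is always in the error term.
  have hswap : c * -u ∈ mulError a A (b + c) (B + C) →
      b * u ∈ mulError a A (b + c) (B + C) := by
    intro hcu
    convert mulError_add_mem hA hBC (right_mul_mem_mulError hA hBC hu) hcu using 1
    ring
  have hu' := hA.2.2.1 u hu
  by_cases hb : b ∈ B
  · rw [mul_comm]
    exact mul_mem_mulError hA hBC hu (hBle hb)
  by_cases hc : c ∈ C
  · refine hswap ?_
    rw [mul_comm]
    exact mul_mem_mulError hA hBC hu' (hCle hc)
  rcases h with h | h
  · have ha : a ∉ A := by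
      intro ha
      have h1 : (1 : ℝ*) ∈ RU (coset a A) := by
        rw [RU, if_pos ((zero_mem_coset_iff hA).2 ha)]
        trivial
      exact (h h1).elim (one_notMem_RU hB hb) (one_notMem_RU hC hc)
    have hRU : ∀ w ∈ A, w / a ∈ RU (coset a A) := fun w hw =>
      (mem_RU_iff hA ha).2 ⟨a, by simpa using hA.1, w, hw, rfl⟩
    rcases h (hRU _ hu) with h' | h'
    · exact mul_mem_mulError_of_div_mem_RU hA hB hBC hBle ha hb hu h'
    · refine hswap (mul_mem_mulError_of_div_mem_RU hA hC hBC hCle ha hc hu' ?_)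
      rw [neg_div]
      exact RU_neg_mem hC hc h'
  · have hi : ¬ Hyperreal.Infinitesimal ((b + c) / c) := fun hi =>
      h (nearlyOpposite_of_infinitesimal hB hC hb hc hi)
    obtain ⟨h0, n, hn⟩ := exists_abs_inv_le_natCast_of_not_infinitesimal hi
    have hbc : b + c ≠ 0 := (div_ne_zero_iff.1 h0).1
    rw [inv_div] at hn
    refine hswap ?_
    convert right_mul_mem_mulError (a := a) (b := b + c) hA hBC
      (hA.mul_mem_of_abs_le_natCast hu' hn) using 1
    field_simp

theorem stmt3 {m n p : ℕ} (A D : Matrix (Fin m) (Fin n) (Set ℝ*))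
    (B C : Matrix (Fin n) (Fin p) (Set ℝ*)) (α β : Set ℝ*)
    (hA : ∀ i j, IsExt (A i j)) (hD : ∀ i j, IsExt (D i j))
    (hB : ∀ i j, IsExt (B i j)) (hC : ∀ i j, IsExt (C i j))
    (hα : IsExt α) (hβ : IsExt β) :
    (((∀ i j, RU α ⊆ RU (A i j) ∪ RU (D i j)) ∨ ∀ i j, ¬ NearlyOpposite (A i j) (D i j)) →
        matSmul α (matAdd A D) = matAdd (matSmul α A) (matSmul α D)) ∧
    (((∀ i j, RU (A i j) ⊆ RU α ∪ RU β) ∨ ¬ NearlyOpposite α β) →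
        matSmul (α + β) A = matAdd (matSmul α A) (matSmul β A)) ∧
    (((∀ i j r j', RU (A i j) ⊆ RU (B r j') ∪ RU (C r j')) ∨
        ∀ r j, ¬ NearlyOpposite (B r j) (C r j)) →
        matMul A (matAdd B C) = matAdd (matMul A B) (matMul A C)) := by
  refine ⟨fun h => ?_, fun h => ?_, fun h => ?_⟩
  · funext i j
    exact emul_add_of_RU_or_not_nearlyOpposite hα (hA i j) (hD i j)
      (h.imp (fun h => h i j) fun h => h i j)
  · funext i j
    simp only [matSmul, matAdd, emul_comm _ (A i j)]
    exact emul_add_of_RU_or_not_nearlyOpposite (hA i j) hα hβ (h.imp_left fun h => h i j)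
  · funext i j
    simp only [matMul, matAdd]
    rw [← Finset.sum_add_distrib]
    refine Finset.sum_congr rfl fun k _ => ?_
    exact emul_add_of_RU_or_not_nearlyOpposite (hA i k) (hB k j) (hC k j)
      (h.imp (fun h => h i k k j) fun h => h k j)
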